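/- arXiv:2311.13552 — 6 statements merged into one kernel-verified Lean document; each statement's English description precedes it below -/
import Mathlib

section
/- Let S ≥ 1, let β be a finite nonempty type, and let ρ and σ be Hermitian complex matrices indexed by (Fin S → Fin 2) × β. Then Tr(Tr_β(ρ) * Tr_β(σ)) = (1 / 2^S) · Σ_{w : Fin S → Fin 4} Tr(ρ * (P_w ⊗ₖ 1)) · Tr(σ * (P_w ⊗ₖ 1)). (This is the recovery of the s-linear projected quantum kernel, defined via reduced density matrices on an S-qubit subsystem, from the generalized trace-induced quantum kernel in the Pauli basis with weights 1/2^S on the Pauli strings supported in s.) -/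
open Matrix BigOperators Kronecker

/-- The four single-qubit Pauli matrices `σ₀ = 1, σ₁ = X, σ₂ = Y, σ₃ = Z`. -/
def pauli : Fin 4 → Matrix (Fin 2) (Fin 2) ℂ :=
  ![1, !![0, 1; 1, 0], !![0, -Complex.I; Complex.I, 0], !![1, 0; 0, -1]]

/-- The Pauli string `P_w = σ_{w 0} ⊗ ⋯ ⊗ σ_{w (n-1)}` associated with a word
`w : Fin n → Fin 4`, realized as a matrix indexed by `Fin n → Fin 2`. -/
def PauliString {n : ℕ} (w : Fin n → Fin 4) :
    Matrix (Fin n → Fin 2) (Fin n → Fin 2) ℂ :=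
  Matrix.of fun a b => ∏ i : Fin n, pauli (w i) (a i) (b i)

/-- The partial trace over the second tensor factor `β` of a matrix on `α × β`. -/
noncomputable def partialTraceRight {α β : Type*} [Fintype β]
    (ρ : Matrix (α × β) (α × β) ℂ) : Matrix α α ℂ :=
  Matrix.of fun a a' => ∑ b : β, ρ (a, b) (a', b)

/-- Completeness relation of the Pauli matrices. -/
theorem sum_pauli_mul_pauli (a b c d : Fin 2) :
    ∑ k, pauli k a b * pauli k c d = if a = d ∧ b = c then 2 else 0 := by
  fin_cases a <;> fin_cases b <;> fin_cases c <;> fin_cases d <;>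
    norm_num [pauli, Fin.sum_univ_succ]

/-- Completeness relation of the Pauli strings. -/
theorem sum_pauliString_mul_pauliString {n : ℕ} (a b c d : Fin n → Fin 2) :
    ∑ w : Fin n → Fin 4, PauliString w a b * PauliString w c d =
      if a = d ∧ b = c then (2 : ℂ) ^ n else 0 := by
  simp only [PauliString, Matrix.of_apply, ← Finset.prod_mul_distrib]
  rw [← Fintype.prod_sum fun i k => pauli k (a i) (b i) * pauli k (c i) (d i)]
  simp only [sum_pauli_mul_pauli]
  split_ifs with h
  · obtain ⟨rfl, rfl⟩ := h
    simp
  · have : ∃ i, ¬(a i = d i ∧ b i = c i) := by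
      by_contra! H
      exact h ⟨funext fun i => (H i).1, funext fun i => (H i).2⟩
    obtain ⟨i, hi⟩ := this
    exact Finset.prod_eq_zero (Finset.mem_univ i) (if_neg hi)

theorem trace_mul_kronecker_one {α β : Type*} [Fintype α] [Fintype β] [DecidableEq β]
    (ρ : Matrix (α × β) (α × β) ℂ) (M : Matrix α α ℂ) :
    Matrix.trace (ρ * (M ⊗ₖ (1 : Matrix β β ℂ))) = Matrix.trace (partialTraceRight ρ * M) := by
  simp only [Matrix.trace, Matrix.diag_apply, Matrix.mul_apply, Fintype.sum_prod_type,
    Matrix.kroneckerMap_apply, Matrix.one_apply, partialTraceRight, Matrix.of_apply,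
    mul_ite, mul_one, mul_zero, Finset.sum_ite_eq', Finset.mem_univ, if_true, Finset.sum_mul]
  exact Finset.sum_congr rfl fun _ _ => Finset.sum_comm

theorem sum_trace_mul_pauliString_mul_trace {n : ℕ}
    (M N : Matrix (Fin n → Fin 2) (Fin n → Fin 2) ℂ) :
    ∑ w : Fin n → Fin 4,
        Matrix.trace (M * PauliString w) * Matrix.trace (N * PauliString w) =
      2 ^ n * Matrix.trace (M * N) := by
  have expand (A B : Matrix (Fin n → Fin 2) (Fin n → Fin 2) ℂ) :
      Matrix.trace (A * B) = ∑ p : (Fin n → Fin 2) × (Fin n → Fin 2), A p.1 p.2 * B p.2 p.1 := by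
    simp only [Matrix.trace, Matrix.diag_apply, Matrix.mul_apply, Fintype.sum_prod_type]
  calc
    _ = ∑ p : (Fin n → Fin 2) × (Fin n → Fin 2), ∑ q : (Fin n → Fin 2) × (Fin n → Fin 2),
          M p.1 p.2 * N q.1 q.2 *
            ∑ w : Fin n → Fin 4, PauliString w p.2 p.1 * PauliString w q.2 q.1 := by
      simp only [expand, Finset.sum_mul_sum]
      simp only [Finset.mul_sum]
      rw [Finset.sum_comm]
      refine Finset.sum_congr rfl fun p _ => ?_
      rw [Finset.sum_comm]
      exact Finset.sum_congr rfl fun q _ => Finset.sum_congr rfl fun w _ => by ring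
    _ = ∑ p : (Fin n → Fin 2) × (Fin n → Fin 2), M p.1 p.2 * N p.2 p.1 * 2 ^ n := by
      refine Finset.sum_congr rfl fun p _ => ?_
      rw [Finset.sum_eq_single (p.2, p.1)]
      · simp [sum_pauliString_mul_pauliString]
      · intro q _ hq
        rw [sum_pauliString_mul_pauliString, if_neg, mul_zero]
        rintro ⟨h₁, h₂⟩
        exact hq (Prod.ext h₁.symm h₂.symm)
      · simp
    _ = _ := by rw [expand, ← Finset.sum_mul, mul_comm]

/-- The s-linear projected quantum kernel on an `S`-qubit subsystem,
`Tr(Tr_β(ρ) Tr_β(σ))`, equals the generalized trace-induced quantum kernel in the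
Pauli basis with weights `1/2^S` on the Pauli strings supported in the subsystem:
`(1/2^S) ∑_w Tr(ρ (P_w ⊗ₖ 1)) Tr(σ (P_w ⊗ₖ 1))`. -/
theorem sLPQK_eq_gtqk_pauli (S : ℕ) (hS : 1 ≤ S)
    (β : Type*) [Fintype β] [DecidableEq β] [Nonempty β]
    (ρ σ : Matrix ((Fin S → Fin 2) × β) ((Fin S → Fin 2) × β) ℂ)
    (hρ : ρᴴ = ρ) (hσ : σᴴ = σ) :
    Matrix.trace (partialTraceRight ρ * partialTraceRight σ) =
      (1 / (2 : ℂ) ^ S) *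
        ∑ w : Fin S → Fin 4,
          Matrix.trace (ρ * (PauliString w ⊗ₖ (1 : Matrix β β ℂ))) *
            Matrix.trace (σ * (PauliString w ⊗ₖ (1 : Matrix β β ℂ))) := by
  simp only [trace_mul_kronecker_one, sum_trace_mul_pauliString_mul_trace]
  field_simp
end

section
/- Let n ≥ 1 and for complex matrices ρ, σ indexed by (Fin n → Fin 2) define, for a subset s ⊆ Fin n, k′_s(ρ, σ) = Σ_{w : supp(w) ⊆ s} Tr(ρ * P_w) · Tr(σ * P_w), and for 0 ≤ H ≤ n define the (non-normalized) H-body kernel k′_H(ρ, σ) = Σ_{w : |supp(w)| = H} Tr(ρ * P_w) · Tr(σ * P_w). Then for every 0 ≤ S ≤ n and all ρ, σ: Σ_{s ⊆ Fin n, |s| = S} k′_s(ρ, σ) = Σ_{H = 0}^{S} (n − H).choose (S − H) · k′_H(ρ, σ). (This is the decomposition of the S-linear projected quantum kernel into H-body linear projected quantum kernels with degeneracies D^{(S,H)} = binom(n−H, S−H).) -/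
open Matrix BigOperators

/-- The support of a Pauli word `w : Fin n → Fin 4`. -/
def pauliSupp {n : ℕ} (w : Fin n → Fin 4) : Finset (Fin n) :=
  Finset.univ.filter fun i => w i ≠ 0

/-- The S-linear projected quantum kernel decomposes into H-body linear
projected quantum kernels with degeneracies `D^(S,H) = (n-H).choose (S-H)`:
`∑_{|s| = S} k'_s(ρ,σ) = ∑_{H=0}^S (n-H).choose (S-H) · k'_H(ρ,σ)`, where
`k'_s(ρ,σ) = ∑_{supp(w) ⊆ s} Tr(ρ P_w) Tr(σ P_w)` and
`k'_H(ρ,σ) = ∑_{|supp(w)| = H} Tr(ρ P_w) Tr(σ P_w)`. -/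
theorem SLPQK_eq_sum_H_body_LPQK (n : ℕ) (hn : 1 ≤ n) (S : ℕ) (hS : S ≤ n)
    (ρ σ : Matrix (Fin n → Fin 2) (Fin n → Fin 2) ℂ) :
    ∑ s ∈ Finset.powersetCard S (Finset.univ : Finset (Fin n)),
        ∑ w ∈ Finset.univ.filter (fun w : Fin n → Fin 4 => pauliSupp w ⊆ s),
          Matrix.trace (ρ * PauliString w) * Matrix.trace (σ * PauliString w) =
      ∑ H ∈ Finset.range (S + 1),
        ((n - H).choose (S - H) : ℂ) *
          ∑ w ∈ Finset.univ.filter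
              (fun w : Fin n → Fin 4 => (pauliSupp w).card = H),
            Matrix.trace (ρ * PauliString w) * Matrix.trace (σ * PauliString w) := by
  simp only [Finset.sum_filter, Finset.mul_sum]
  rw [Finset.sum_comm, Finset.sum_comm (s := Finset.range (S + 1))]
  refine Finset.sum_congr rfl fun w _ => ?_
  simp only [mul_ite, mul_zero]
  rw [← Finset.sum_filter, Finset.sum_const, nsmul_eq_mul, Finset.sum_ite_eq]
  split_ifs with h
  · rw [Finset.card_filter_powersetCard_subset _ _ _ (Finset.subset_univ _)
      (Nat.lt_succ_iff.mp (Finset.mem_range.mp h)), Finset.card_univ, Fintype.card_fin]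
  · rw [Finset.filter_false_of_mem, Finset.card_empty, Nat.cast_zero, zero_mul]
    intro s hs hw
    have := Finset.card_le_card hw
    rw [(Finset.mem_powersetCard.mp hs).2] at this
    exact h (Finset.mem_range.mpr (Nat.lt_succ_of_le this))
end

section
/- Let n ≥ 1 and with the notation k′_s(ρ, σ) = Σ_{w : supp(w) ⊆ s} Tr(ρ * P_w) · Tr(σ * P_w) and k′_H(ρ, σ) = Σ_{w : |supp(w)| = H} Tr(ρ * P_w) · Tr(σ * P_w), for every 0 ≤ H ≤ n and all complex matrices ρ, σ indexed by (Fin n → Fin 2): k′_H(ρ, σ) = Σ_{S = 0}^{H} (−1)^{H−S} · (n − S).choose (H − S) · (Σ_{s ⊆ Fin n, |s| = S} k′_s(ρ, σ)). (This is the closed form expressing the H-body linear projected quantum kernel as an alternating-sign linear combination of the S-linear projected quantum kernels with S ≤ H.) -/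
open Matrix BigOperators

/-- The number of `S`-element supersets of `t` in a finite type. -/
theorem card_filter_superset_powersetCard {α : Type*} [Fintype α] [DecidableEq α]
    (t : Finset α) (S : ℕ) :
    ((Finset.powersetCard S (Finset.univ : Finset α)).filter (t ⊆ ·)).card =
      if t.card ≤ S then (Fintype.card α - t.card).choose (S - t.card) else 0 := by
  split_ifs with h
  · rw [← Finset.card_compl, ← Finset.card_powersetCard]
    refine Finset.card_nbij' (· \ t) (· ∪ t) ?_ ?_ ?_ ?_
    · intro s hs
      simp only [Finset.coe_filter, Finset.mem_powersetCard_univ, Set.mem_ofPred_eq] at hs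
      simp only [Finset.mem_coe, Finset.mem_powersetCard]
      refine ⟨fun x hx => ?_, by rw [Finset.card_sdiff_of_subset hs.2, hs.1]⟩
      simpa using (Finset.mem_sdiff.1 hx).2
    · intro u hu
      simp only [Finset.mem_coe, Finset.mem_powersetCard] at hu
      have hd : Disjoint u t := Finset.subset_compl_iff_disjoint_right.1 hu.1
      simp only [Finset.coe_filter, Finset.mem_powersetCard_univ, Set.mem_ofPred_eq]
      refine ⟨?_, Finset.subset_union_right⟩
      rw [Finset.card_union_of_disjoint hd, hu.2]
      omega
    · intro s hs
      simp only [Finset.coe_filter, Set.mem_ofPred_eq] at hs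
      exact Finset.sdiff_union_of_subset hs.2
    · intro u hu
      simp only [Finset.mem_coe, Finset.mem_powersetCard] at hu
      exact Finset.union_sdiff_cancel_right (Finset.subset_compl_iff_disjoint_right.1 hu.1)
  · rw [Finset.card_eq_zero, Finset.filter_eq_empty_iff]
    intro s hs hts
    rw [Finset.mem_powersetCard_univ] at hs
    exact h (hs ▸ Finset.card_le_card hts)

/-- Binomial inversion, as an orthogonality relation for products of binomial coefficients. -/
theorem sum_neg_one_pow_mul_choose_mul_choose {R : Type*} [CommRing R]
    {n H : ℕ} (hH : H ≤ n) (k : ℕ) :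
    ∑ S ∈ Finset.range (H + 1), (-1 : R) ^ (H - S) * ((n - S).choose (H - S) : R) *
        ((if k ≤ S then (n - k).choose (S - k) else 0 : ℕ) : R) =
      if k = H then 1 else 0 := by
  rcases lt_or_ge H k with h | h
  · rw [if_neg h.ne']
    refine Finset.sum_eq_zero fun S hS => ?_
    rw [if_neg (by have := Finset.mem_range.1 hS; omega)]
    simp
  obtain ⟨m, rfl⟩ := Nat.exists_eq_add_of_le h
  rw [add_assoc, Finset.sum_range_add, Finset.sum_eq_zero, zero_add]
  · have hterm : ∀ j ∈ Finset.range (m + 1),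
        (-1 : R) ^ (k + m - (k + j)) * ((n - (k + j)).choose (k + m - (k + j)) : R) *
          ((if k ≤ k + j then (n - k).choose (k + j - k) else 0 : ℕ) : R) =
        ((n - k).choose m : R) * (1 ^ j * (-1) ^ (m - j) * (m.choose j : R)) := by
      intro j hj
      have hjm : j ≤ m := Nat.lt_succ_iff.1 (Finset.mem_range.1 hj)
      have hc : ((n - k).choose m : R) * (m.choose j : R) =
          ((n - k).choose j : R) * ((n - k - j).choose (m - j) : R) := by
        rw [← Nat.cast_mul, Nat.choose_mul hjm, Nat.cast_mul]
      rw [if_pos (Nat.le_add_right k j), Nat.add_sub_add_left, Nat.add_sub_cancel_left,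
        ← Nat.sub_sub]
      linear_combination -(-1 : R) ^ (m - j) * hc
    rw [Finset.sum_congr rfl hterm, ← Finset.mul_sum, ← add_pow, add_neg_cancel]
    rcases Nat.eq_zero_or_pos m with rfl | hm
    · simp
    · rw [zero_pow hm.ne', mul_zero, if_neg (by omega)]
  · intro S hS
    rw [if_neg (by have := Finset.mem_range.1 hS; omega)]
    simp

/-- Summing a function over the elements whose associated set has size `H`, expressed through
its sums over the elements whose associated set lies in a given subset. -/
theorem sum_filter_card_eq_alternating_sum {ι α R : Type*} [Fintype ι] [Fintype α]
    [DecidableEq α] [CommRing R] (supp : ι → Finset α) (f : ι → R) {H : ℕ}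
    (hH : H ≤ Fintype.card α) :
    ∑ w ∈ Finset.univ.filter (fun w => (supp w).card = H), f w =
      ∑ S ∈ Finset.range (H + 1),
        (-1 : R) ^ (H - S) * ((Fintype.card α - S).choose (H - S) : R) *
          ∑ s ∈ Finset.powersetCard S (Finset.univ : Finset α),
            ∑ w ∈ Finset.univ.filter (fun w => supp w ⊆ s), f w := by
  have hinner : ∀ S, ∑ s ∈ Finset.powersetCard S (Finset.univ : Finset α),
      ∑ w ∈ Finset.univ.filter (fun w => supp w ⊆ s), f w =
      ∑ w, ((if (supp w).card ≤ S then
        (Fintype.card α - (supp w).card).choose (S - (supp w).card) else 0 : ℕ) : R) * f w := by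
    intro S
    simp_rw [Finset.sum_filter]
    rw [Finset.sum_comm]
    refine Finset.sum_congr rfl fun w _ => ?_
    rw [← card_filter_superset_powersetCard, ← Finset.sum_filter, Finset.sum_const,
      nsmul_eq_mul]
  simp_rw [hinner, Finset.mul_sum, ← mul_assoc]
  rw [Finset.sum_comm, Finset.sum_filter]
  refine Finset.sum_congr rfl fun w _ => ?_
  rw [← Finset.sum_mul, sum_neg_one_pow_mul_choose_mul_choose hH, ite_mul, one_mul, zero_mul]

/-- Closed form for the (non-normalized) H-body linear projected quantum
kernel as an alternating-sign combination of the S-LPQKs: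
`k'_H(ρ,σ) = ∑_{S=0}^H (-1)^(H-S) (n-S).choose (H-S) · ∑_{|s| = S} k'_s(ρ,σ)`. -/
theorem H_body_LPQK_eq_alternating_sum_SLPQK (n : ℕ) (hn : 1 ≤ n)
    (H : ℕ) (hH : H ≤ n)
    (ρ σ : Matrix (Fin n → Fin 2) (Fin n → Fin 2) ℂ) :
    ∑ w ∈ Finset.univ.filter (fun w : Fin n → Fin 4 => (pauliSupp w).card = H),
        Matrix.trace (ρ * PauliString w) * Matrix.trace (σ * PauliString w) =
      ∑ S ∈ Finset.range (H + 1),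
        (-1 : ℂ) ^ (H - S) * ((n - S).choose (H - S) : ℂ) *
          ∑ s ∈ Finset.powersetCard S (Finset.univ : Finset (Fin n)),
            ∑ w ∈ Finset.univ.filter (fun w : Fin n → Fin 4 => pauliSupp w ⊆ s),
              Matrix.trace (ρ * PauliString w) * Matrix.trace (σ * PauliString w) := by
  simpa only [Fintype.card_fin] using
    sum_filter_card_eq_alternating_sum pauliSupp
      (fun w => Matrix.trace (ρ * PauliString w) * Matrix.trace (σ * PauliString w))
      (H := H) (by simpa using hH)
end

section
/- Let (X, μ) be a measure space, let d ≥ 1, and let ρ : X → Matrix (Fin d) (Fin d) ℂ be such that the map x ↦ ρ(x) ⊗ₖ ρ(x) is Bochner integrable with respect to μ. Set O_μ = ∫ ρ(x′) ⊗ₖ ρ(x′) dμ(x′). Then for every matrix M : Matrix (Fin d) (Fin d) ℂ and every x ∈ X, the function x′ ↦ Tr(ρ(x) * ρ(x′)) · Tr(ρ(x′) * M) is integrable and ∫ Tr(ρ(x) * ρ(x′)) · Tr(ρ(x′) * M) dμ(x′) = Tr( Tr₁(O_μ * (M ⊗ₖ 1)) * ρ(x) ). (This expresses the action of the integral operator of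 the global fidelity quantum kernel on a quantum model Tr(ρ(·)M) via the linear map L(M) = Tr₁[O_μ (M ⊗ 𝟙)].) -/
open Matrix BigOperators Kronecker MeasureTheory

/-- The partial trace over the first tensor factor of a matrix on `Fin d × Fin d`. -/
noncomputable def partialTraceLeft {d : ℕ}
    (C : Matrix (Fin d × Fin d) (Fin d × Fin d) ℂ) : Matrix (Fin d) (Fin d) ℂ :=
  Matrix.of fun b b' => ∑ a : Fin d, C (a, b) (a, b')

/-- Entrywise expansion of `Tr(Tr₁(C (M ⊗ 𝟙)) A)`. -/
theorem trace_partialTraceLeft_mul {d : ℕ} (C : Matrix (Fin d × Fin d) (Fin d × Fin d) ℂ)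
    (M A : Matrix (Fin d) (Fin d) ℂ) :
    trace (partialTraceLeft (C * (M ⊗ₖ (1 : Matrix (Fin d) (Fin d) ℂ))) * A) =
      ∑ b, ∑ b', ∑ a, ∑ c, C (a, b) (c, b') * (M c a * A b' b) := by
  simp only [trace, diag_apply, mul_apply, partialTraceLeft, of_apply, Fintype.sum_prod_type,
    kroneckerMap_apply, one_apply, mul_ite, mul_one, mul_zero, Finset.sum_ite_eq',
    Finset.mem_univ, if_true, Finset.sum_mul, mul_assoc]

/-- The product `Tr(A B) Tr(B M)` as a linear functional of `B ⊗ B`. -/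
theorem trace_mul_trace_eq_trace_partialTraceLeft {d : ℕ} (A B M : Matrix (Fin d) (Fin d) ℂ) :
    trace (A * B) * trace (B * M) =
      trace (partialTraceLeft ((B ⊗ₖ B) * (M ⊗ₖ (1 : Matrix (Fin d) (Fin d) ℂ))) * A) := by
  rw [trace_partialTraceLeft_mul, trace_mul_comm A B]
  simp only [trace, diag_apply, mul_apply, kroneckerMap_apply, Finset.sum_mul]
  refine Finset.sum_congr rfl fun b _ => Finset.sum_congr rfl fun b' _ => ?_
  simp only [Finset.mul_sum]
  refine Finset.sum_congr rfl fun a _ => Finset.sum_congr rfl fun c _ => ?_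
  ring

/-- The integral operator of the global fidelity quantum kernel acting on
the quantum model `Tr(ρ(·) M)` is given by the linear map `L(M) = Tr₁[O_μ (M ⊗ 𝟙)]`,
where `O_μ = ∫ ρ(x') ⊗ₖ ρ(x') dμ(x')`:
`∫ Tr(ρ(x) ρ(x')) Tr(ρ(x') M) dμ(x') = Tr(Tr₁(O_μ (M ⊗ₖ 1)) ρ(x))`,
the integrand being integrable. -/
theorem integral_operator_gfqk (X : Type*) [MeasurableSpace X] (μ : Measure X)
    (d : ℕ) (hd : 1 ≤ d) (ρ : X → Matrix (Fin d) (Fin d) ℂ)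
    (hInt : ∀ p q : Fin d × Fin d, Integrable (fun x => (ρ x ⊗ₖ ρ x) p q) μ)
    (M : Matrix (Fin d) (Fin d) ℂ) (x : X) :
    Integrable
        (fun x' => Matrix.trace (ρ x * ρ x') * Matrix.trace (ρ x' * M)) μ ∧
      ∫ x', Matrix.trace (ρ x * ρ x') * Matrix.trace (ρ x' * M) ∂μ =
        Matrix.trace
          (partialTraceLeft
              ((Matrix.of fun p q : Fin d × Fin d => ∫ x', (ρ x' ⊗ₖ ρ x') p q ∂μ) *
                (M ⊗ₖ (1 : Matrix (Fin d) (Fin d) ℂ))) * ρ x) := by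
  simp only [trace_mul_trace_eq_trace_partialTraceLeft, trace_partialTraceLeft_mul, of_apply]
  have hterm : ∀ b b' a c : Fin d, Integrable
      (fun x' => (ρ x' ⊗ₖ ρ x') (a, b) (c, b') * (M c a * ρ x b' b)) μ :=
    fun b b' a c => (hInt (a, b) (c, b')).mul_const _
  have hc := fun b b' a => integrable_finsetSum Finset.univ fun c _ => hterm b b' a c
  have ha := fun b b' => integrable_finsetSum Finset.univ fun a _ => hc b b' a
  have hb := fun b => integrable_finsetSum Finset.univ fun b' _ => ha b b'
  refine ⟨integrable_finsetSum _ fun b _ => hb b, ?_⟩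
  rw [integral_finsetSum _ fun b _ => hb b]
  refine Finset.sum_congr rfl fun b _ => ?_
  rw [integral_finsetSum _ fun b' _ => ha b b']
  refine Finset.sum_congr rfl fun b' _ => ?_
  rw [integral_finsetSum _ fun a _ => hc b b' a]
  refine Finset.sum_congr rfl fun a _ => ?_
  rw [integral_finsetSum _ fun c _ => hterm b b' a c]
  exact Finset.sum_congr rfl fun c _ => integral_mul_const _ _
end

section
/- Let (X, μ) be a measure space, d ≥ 1, and ρ : X → Matrix (Fin d) (Fin d) ℂ with x ↦ ρ(x) ⊗ₖ ρ(x) Bochner integrable; set O_μ = ∫ ρ(x′) ⊗ₖ ρ(x′) dμ(x′) and define L(M) = Tr₁(O_μ * (M ⊗ₖ 1)). Suppose A is a matrix with L(A) = γ • A for some real γ. Then for every matrix B: ∫ Tr(ρ(x) * A) · Tr(ρ(x) * B) dμ(x) = γ · Tr(A * B). In particular, if (A_i) is a family of eigenmatrices of L with eigenvalues γ_i satisfying Tr(A_i * A_j) = δ_{ij}, then ∫ Tr(ρ(x) * A_i) · Tr(ρ(x) * A_j) dμ(x) = γ_i δ_{ij}, i.e. the Mercer basis functions Tr(ρ(·)A_i)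 are orthogonal in L²(μ) with squared norms γ_i. -/
open Matrix BigOperators Kronecker MeasureTheory

theorem trace_partialTraceLeft {d : ℕ} (C : Matrix (Fin d × Fin d) (Fin d × Fin d) ℂ) :
    (partialTraceLeft C).trace = C.trace := by
  simp only [partialTraceLeft, Matrix.trace, Matrix.diag, Matrix.of_apply,
    Fintype.sum_prod_type_right]

theorem partialTraceLeft_mul {d : ℕ} (C : Matrix (Fin d × Fin d) (Fin d × Fin d) ℂ)
    (B : Matrix (Fin d) (Fin d) ℂ) :
    partialTraceLeft C * B = partialTraceLeft (C * ((1 : Matrix (Fin d) (Fin d) ℂ) ⊗ₖ B)) := by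
  ext b b'
  simp only [partialTraceLeft, Matrix.mul_apply, Matrix.of_apply, Fintype.sum_prod_type_right,
    Matrix.kroneckerMap_apply, Matrix.one_apply, ite_mul, one_mul, zero_mul, mul_ite, mul_zero,
    Finset.sum_ite_eq', Finset.mem_univ, if_true, Finset.sum_mul]
  rw [Finset.sum_comm]

theorem integral_trace_mul_const {X n : Type*} [MeasurableSpace X] [Fintype n] {μ : Measure X}
    {F : X → Matrix n n ℂ} (hF : ∀ p q, Integrable (fun x => F x p q) μ) (D : Matrix n n ℂ) :
    ∫ x, (F x * D).trace ∂μ = ((Matrix.of fun p q => ∫ x, F x p q ∂μ) * D).trace := by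
  simp only [Matrix.trace, Matrix.diag, Matrix.mul_apply, Matrix.of_apply]
  rw [integral_finsetSum _ fun p _ => integrable_finsetSum _ fun q _ => (hF p q).mul_const _]
  refine Finset.sum_congr rfl fun p _ => ?_
  rw [integral_finsetSum _ fun q _ => (hF p q).mul_const _]
  exact Finset.sum_congr rfl fun q _ => integral_mul_const _ _

/-- If `A` is an eigenmatrix of the linear map
`L(M) = Tr₁(O_μ (M ⊗ₖ 1))` (with `O_μ = ∫ ρ(x') ⊗ₖ ρ(x') dμ(x')`) with real
eigenvalue `γ`, then for every matrix `B`: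
`∫ Tr(ρ(x) A) Tr(ρ(x) B) dμ(x) = γ · Tr(A B)`; in particular the Mercer basis
functions `Tr(ρ(·) A_i)` are orthogonal in `L²(μ)` with squared norms `γ_i`. -/
theorem mercer_eigenmatrix_orthogonality (X : Type*) [MeasurableSpace X]
    (μ : Measure X) (d : ℕ) (hd : 1 ≤ d) (ρ : X → Matrix (Fin d) (Fin d) ℂ)
    (hInt : ∀ p q : Fin d × Fin d, Integrable (fun x => (ρ x ⊗ₖ ρ x) p q) μ)
    (A : Matrix (Fin d) (Fin d) ℂ) (γ : ℝ)
    (hA : partialTraceLeft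
        ((Matrix.of fun p q : Fin d × Fin d => ∫ x', (ρ x' ⊗ₖ ρ x') p q ∂μ) *
          (A ⊗ₖ (1 : Matrix (Fin d) (Fin d) ℂ))) = (γ : ℂ) • A) :
    ∀ B : Matrix (Fin d) (Fin d) ℂ,
      ∫ x, Matrix.trace (ρ x * A) * Matrix.trace (ρ x * B) ∂μ =
        (γ : ℂ) * Matrix.trace (A * B) := by
  intro B
  have htrace : ∀ x, Matrix.trace (ρ x * A) * Matrix.trace (ρ x * B) =
      Matrix.trace ((ρ x ⊗ₖ ρ x) * (A ⊗ₖ B)) := fun x => by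
    rw [← Matrix.mul_kronecker_mul, Matrix.trace_kronecker]
  simp_rw [htrace]
  rw [integral_trace_mul_const hInt, ← smul_eq_mul (γ : ℂ), ← Matrix.trace_smul,
    ← Matrix.smul_mul, ← hA,
    partialTraceLeft_mul, trace_partialTraceLeft, Matrix.mul_assoc, ← Matrix.mul_kronecker_mul,
    Matrix.mul_one, Matrix.one_mul]
end

section
/- Let n ≥ 1, d = 2^n, let (X, μ) be a measure space, and let ρ : X → Matrix (Fin d) (Fin d) ℂ take Hermitian values with x ↦ ρ(x) ⊗ₖ ρ(x) Bochner integrable. Let (A_i)_{i : Fin (4^n)} be an orthonormal Hermitian basis satisfying ∫ Tr(ρ(x) * A_i) · Tr(ρ(x) * A_j) dμ(x) = γ_i · δ_{ij} with γ_i ≥ 0, and let w : Fin (4^n) → ℝ with w_i ≥ 0. Define the generalized trace-induced quantum kernel k(x, x′) = Σ_{i : Fin (4^n)} 2^n · w_i · Tr(ρ(x) * A_i) · Tr(ρ(x′) * A_i). Then for every index j with γ_j > 0, setting φ_j(x) = Tr(ρ(x) * A_j) / √γ_j, the function x′ ↦ k(x, x′) · φ_j(x′) is integrable for each x ∈ X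 and ∫ k(x, x′) · φ_j(x′) dμ(x′) = 2^n · w_j · γ_j · φ_j(x). (The generalized trace-induced quantum kernel shares the Mercer eigenfunctions φ_j of the global fidelity quantum kernel, with eigenvalues rescaled from γ_j to 2^n w_j γ_j.) -/
open Matrix BigOperators Kronecker MeasureTheory

/-- If the entries of `ρ ⊗ₖ ρ` are integrable, then so is the product of any two trace functionals
`x ↦ Tr(ρ(x) B)` and `x ↦ Tr(ρ(x) C)`. -/
theorem integrable_trace_mul_trace_of_kronecker {X ι : Type*} [Fintype ι] [MeasurableSpace X]
    {μ : Measure X} {ρ : X → Matrix ι ι ℂ}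
    (hρ : ∀ p q : ι × ι, Integrable (fun x => (ρ x ⊗ₖ ρ x) p q) μ) (B C : Matrix ι ι ℂ) :
    Integrable (fun x => Matrix.trace (ρ x * B) * Matrix.trace (ρ x * C)) μ := by
  have key : (fun x => Matrix.trace (ρ x * B) * Matrix.trace (ρ x * C)) = fun x =>
      ∑ a, ∑ c, ∑ b, ∑ d, (ρ x ⊗ₖ ρ x) (a, c) (b, d) * (B b a * C d c) := by
    funext x
    simp only [Matrix.trace, Matrix.diag_apply, Matrix.mul_apply, Finset.sum_mul_sum,
      Matrix.kroneckerMap_apply, mul_mul_mul_comm]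
  rw [key]
  exact integrable_finsetSum _ fun a _ => integrable_finsetSum _ fun c _ =>
    integrable_finsetSum _ fun b _ => integrable_finsetSum _ fun d _ =>
      (hρ (a, c) (b, d)).mul_const _

/-- The generalized trace-induced quantum kernel
`k(x,x') = ∑ i, 2^n w_i Tr(ρ(x) A_i) Tr(ρ(x') A_i)` built on a Mercer orthonormal
Hermitian basis `(A_i)` (with `∫ Tr(ρ(x) A_i) Tr(ρ(x) A_j) dμ = γ_i δ_{ij}`) shares
the Mercer eigenfunctions `φ_j(x) = Tr(ρ(x) A_j)/√γ_j` of the global fidelity quantum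
kernel, with eigenvalues rescaled to `2^n w_j γ_j`:
`∫ k(x,x') φ_j(x') dμ(x') = 2^n w_j γ_j φ_j(x)`, the integrand being integrable. -/
theorem gtqk_mercer_eigenfunctions (n : ℕ) (hn : 1 ≤ n)
    (X : Type*) [MeasurableSpace X] (μ : Measure X)
    (ρ : X → Matrix (Fin (2 ^ n)) (Fin (2 ^ n)) ℂ)
    (hρHerm : ∀ x, (ρ x)ᴴ = ρ x)
    (hInt : ∀ p q : Fin (2 ^ n) × Fin (2 ^ n),
      Integrable (fun x => (ρ x ⊗ₖ ρ x) p q) μ)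
    (A : Fin (4 ^ n) → Matrix (Fin (2 ^ n)) (Fin (2 ^ n)) ℂ)
    (hHerm : ∀ i, (A i)ᴴ = A i)
    (hOrth : ∀ i j, Matrix.trace (A i * A j) = if i = j then 1 else 0)
    (γ : Fin (4 ^ n) → ℝ) (hγ : ∀ i, 0 ≤ γ i)
    (hMercer : ∀ i j,
      ∫ x, Matrix.trace (ρ x * A i) * Matrix.trace (ρ x * A j) ∂μ =
        if i = j then (γ i : ℂ) else 0)
    (w : Fin (4 ^ n) → ℝ) (hw : ∀ i, 0 ≤ w i)
    (j : Fin (4 ^ n)) (hγj : 0 < γ j) (x : X) :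
    Integrable
        (fun x' =>
          (∑ i : Fin (4 ^ n),
              (2 ^ n : ℂ) * (w i : ℂ) * Matrix.trace (ρ x * A i) *
                Matrix.trace (ρ x' * A i)) *
            (Matrix.trace (ρ x' * A j) / (Real.sqrt (γ j) : ℂ))) μ ∧
      ∫ x',
          (∑ i : Fin (4 ^ n),
              (2 ^ n : ℂ) * (w i : ℂ) * Matrix.trace (ρ x * A i) *
                Matrix.trace (ρ x' * A i)) *
            (Matrix.trace (ρ x' * A j) / (Real.sqrt (γ j) : ℂ)) ∂μ =
        (2 ^ n : ℂ) * (w j : ℂ) * (γ j : ℂ) *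
          (Matrix.trace (ρ x * A j) / (Real.sqrt (γ j) : ℂ)) := by
  have hterm (i : Fin (4 ^ n)) := (integrable_trace_mul_trace_of_kronecker hInt (A i) (A j)).const_mul
    ((2 ^ n : ℂ) * (w i : ℂ) * Matrix.trace (ρ x * A i) / (Real.sqrt (γ j) : ℂ))
  have hsum : (fun x' =>
      (∑ i : Fin (4 ^ n),
          (2 ^ n : ℂ) * (w i : ℂ) * Matrix.trace (ρ x * A i) * Matrix.trace (ρ x' * A i)) *
        (Matrix.trace (ρ x' * A j) / (Real.sqrt (γ j) : ℂ))) = fun x' =>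
      ∑ i : Fin (4 ^ n),
        (2 ^ n : ℂ) * (w i : ℂ) * Matrix.trace (ρ x * A i) / (Real.sqrt (γ j) : ℂ) *
          (Matrix.trace (ρ x' * A i) * Matrix.trace (ρ x' * A j)) := by
    funext x'
    rw [Finset.sum_mul]
    exact Finset.sum_congr rfl fun i _ => by ring
  rw [hsum]
  refine ⟨integrable_finsetSum _ fun i _ => hterm i, ?_⟩
  rw [integral_finsetSum _ fun i _ => hterm i]
  simp only [integral_const_mul, hMercer, mul_ite, mul_zero, Finset.sum_ite_eq', Finset.mem_univ,
    if_true]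
  ring
end
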